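/- Comparison principle for the discrete biharmonic operator: let u ∈ l²_{h,0} be a grid function with Hermitian derivative u_x ∈ l²_{h,0}. If (δ⁴ₓu)_j ≥ 0 for all 1 ≤ j ≤ N−1, then u_j ≥ 0 for all 0 ≤ j ≤ N. -/

import Mathlib

open Set

/-- `IsHermDeriv N u v`: `v` is the Hermitian derivative of the grid function
`u ∈ l²_{h,0}` (with `h = 1/N`). -/
def IsHermDeriv (N : ℕ) (u v : ℕ → ℝ) : Prop :=
  v 0 = 0 ∧ v N = 0 ∧
  ∀ j : ℕ, 1 ≤ j → j ≤ N - 1 →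
    (1/6) * v (j-1) + (2/3) * v j + (1/6) * v (j+1)
      = (u (j+1) - u (j-1)) / (2 * ((1:ℝ)/N))

/-- The discrete biharmonic operator `δ⁴ₓ` (with `h = 1/N`). -/
noncomputable def dbh (N : ℕ) (u ux : ℕ → ℝ) (j : ℕ) : ℝ :=
  (12 / ((1:ℝ)/N)^2) *
    ((ux (j+1) - ux (j-1)) / (2 * ((1:ℝ)/N))
      - (u (j+1) - 2 * u j + u (j-1)) / ((1:ℝ)/N)^2)

/-- The cubic polynomial with coefficients `c`. -/
def cubicEval (c : Fin 4 → ℝ) (y : ℝ) : ℝ :=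
  c 0 + c 1 * y + c 2 * y ^ 2 + c 3 * y ^ 3

/-- The concomitant `s''' p - s'' p' + s' p'' - s p'''` at the right of the node `j`, where `s` is
the piecewise cubic with values `u` and derivatives `w` at the integers and `p` is the cubic with
coefficients `c`. -/
def splineConcomitant (u w : ℕ → ℝ) (c : Fin 4 → ℝ) (j : ℕ) : ℝ :=
  (6 * (w j + w (j + 1)) - 12 * (u (j + 1) - u j)) * cubicEval c j
    - (6 * (u (j + 1) - u j) - 4 * w j - 2 * w (j + 1)) * (c 1 + 2 * c 2 * j + 3 * c 3 * j ^ 2)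
    + w j * (2 * c 2 + 6 * c 3 * j) - u j * (6 * c 3)

/-- The concomitant is constant on each cell, so it can be evaluated at the right end of the
cell. -/
lemma splineConcomitant_eq_right (u w : ℕ → ℝ) (c : Fin 4 → ℝ) (j : ℕ) :
    splineConcomitant u w c j =
      (6 * (w j + w (j + 1)) - 12 * (u (j + 1) - u j)) * cubicEval c (j + 1)
        - (-6 * (u (j + 1) - u j) + 2 * w j + 4 * w (j + 1))
          * (c 1 + 2 * c 2 * (j + 1) + 3 * c 3 * (j + 1) ^ 2)
        + w (j + 1) * (2 * c 2 + 6 * c 3 * (j + 1)) - u (j + 1) * (6 * c 3) := by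
  simp only [splineConcomitant, cubicEval]
  ring

/-- Across a node where the spline is `C²`, the concomitant jumps by the jump of the third
derivative times the value of the cubic. -/
lemma splineConcomitant_succ {u w : ℕ → ℝ} (c : Fin 4 → ℝ) {j : ℕ}
    (hj : w j + 4 * w (j + 1) + w (j + 2) = 3 * (u (j + 2) - u j)) :
    splineConcomitant u w c (j + 1) = splineConcomitant u w c j +
      (6 * (w (j + 2) - w j) - 12 * (u (j + 2) - 2 * u (j + 1) + u j))
        * cubicEval c ((j + 1 : ℕ) : ℝ) := by
  rw [splineConcomitant_eq_right u w c j]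
  simp only [splineConcomitant, cubicEval]
  push_cast
  linear_combination 2 * (c 1 + 2 * c 2 * (j + 1) + 3 * c 3 * (j + 1) ^ 2) * hj

lemma splineConcomitant_le {N : ℕ} {u w : ℕ → ℝ} (c : Fin 4 → ℝ)
    (hC : ∀ j, j + 1 < N → w j + 4 * w (j + 1) + w (j + 2) = 3 * (u (j + 2) - u j))
    (hF : ∀ j, j + 1 < N → 0 ≤ 6 * (w (j + 2) - w j) - 12 * (u (j + 2) - 2 * u (j + 1) + u j))
    {a b : ℕ} (hab : a ≤ b) (hb : b < N) (hc : ∀ k : ℕ, k ≤ b → a ≤ k → 0 ≤ cubicEval c k) :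
    splineConcomitant u w c a ≤ splineConcomitant u w c b := by
  induction b, hab using Nat.le_induction with
  | base => exact le_rfl
  | succ k hk ih =>
    rw [splineConcomitant_succ c (hC k hb)]
    have := ih (by omega) fun m hm ha => hc m (by omega) ha
    have := mul_nonneg (hF k hb) (hc (k + 1) le_rfl (by omega))
    linarith

/-- A clamped cubic spline at integer nodes whose third derivative has nonnegative jumps is
nonnegative at the nodes. -/
lemma nonneg_of_clamped_spline {N : ℕ} {u w : ℕ → ℝ}
    (hu0 : u 0 = 0) (huN : u N = 0) (hw0 : w 0 = 0) (hwN : w N = 0)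
    (hC : ∀ j, j + 1 < N → w j + 4 * w (j + 1) + w (j + 2) = 3 * (u (j + 2) - u j))
    (hF : ∀ j, j + 1 < N → 0 ≤ 6 * (w (j + 2) - w j) - 12 * (u (j + 2) - 2 * u (j + 1) + u j))
    {i : ℕ} (hi : i < N) : 0 ≤ u i := by
  obtain ⟨M, rfl⟩ : ∃ M, N = M + 1 := ⟨N - 1, by omega⟩
  set L : ℝ := (M : ℝ) + 1 with hL
  set x : ℝ := (i : ℝ) with hx
  have hx0 : 0 ≤ x := Nat.cast_nonneg i
  have hxL : x ≤ L := by rw [hx, hL]; exact_mod_cast hi.le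
  have hL0 : 0 < L := by positivity
  -- The two branches of `6 L³` times the Green function of the clamped beam of length `L`.
  let p : Fin 4 → ℝ := ![0, 0, (L - x) ^ 2 * (3 * x * L), -((L - x) ^ 2 * (L + 2 * x))]
  let q : Fin 4 → ℝ := ![-(x ^ 3 * L ^ 3), 3 * x ^ 2 * L ^ 3,
    -(3 * x ^ 2 * L * (2 * L - x)), x ^ 2 * (3 * L - 2 * x)]
  have hp (y : ℝ) : cubicEval p y =
      y ^ 2 * (L - x) ^ 2 * (2 * x * (L - x) + (x - y) * (L + 2 * x)) := by
    simp [cubicEval, p]; ring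
  have hq (y : ℝ) : cubicEval q y =
      (L - y) ^ 2 * x ^ 2 * (2 * x * (L - x) + (y - x) * (3 * L - 2 * x)) := by
    simp [cubicEval, q]; ring
  have hleft := splineConcomitant_le p hC hF (Nat.zero_le i) hi fun k hk _ => by
    have : (k : ℝ) ≤ x := by rw [hx]; exact_mod_cast hk
    rw [hp]
    have := sub_nonneg.2 this
    have := sub_nonneg.2 hxL
    positivity
  have hright := splineConcomitant_le q hC hF (Nat.le_of_lt_succ hi) M.lt_succ_self
    fun k _ hk => by
      have : x ≤ (k : ℝ) := by rw [hx]; exact_mod_cast hk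
      rw [hq]
      have := sub_nonneg.2 this
      have := sub_nonneg.2 hxL
      have : 0 ≤ 3 * L - 2 * x := by linarith
      positivity
  have hzero : splineConcomitant u w p 0 = 0 := by
    simp [splineConcomitant, cubicEval, p, hu0, hw0]
  have hlast : splineConcomitant u w q M = 0 := by
    rw [splineConcomitant_eq_right, huN, hwN, ← hL, hq]
    simp [q]
    exact Or.inr (by ring)
  have hjump : splineConcomitant u w p i - splineConcomitant u w q i = 6 * L ^ 3 * u i := by
    simp [splineConcomitant, cubicEval, p, q, ← hx]
    ring
  refine nonneg_of_mul_nonneg_right (a := 6 * L ^ 3) ?_ (by positivity)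
  linarith

/-- Comparison principle for the discrete biharmonic operator: if `(δ⁴ₓu)_j ≥ 0` for all
interior nodes `1 ≤ j ≤ N-1`, then `u_j ≥ 0` for all `0 ≤ j ≤ N`. -/
theorem discrete_biharmonic_comparison_principle
    (N : ℕ) (hN : 2 ≤ N) (u ux : ℕ → ℝ)
    (hu0 : u 0 = 0) (huN : u N = 0) (hux : IsHermDeriv N u ux)
    (hpos : ∀ j : ℕ, 1 ≤ j → j ≤ N - 1 → 0 ≤ dbh N u ux j) :
    ∀ j : ℕ, j ≤ N → 0 ≤ u j := by
  obtain ⟨h0, hNN, hH⟩ := hux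
  have hN0 : (0 : ℝ) < N := by exact_mod_cast (by omega : 0 < N)
  intro i hi
  rcases hi.eq_or_lt with rfl | hi
  · exact huN.ge
  refine nonneg_of_clamped_spline (w := fun j => ux j / N) hu0 huN (by simp [h0]) (by simp [hNN])
    (fun j hj => ?_) (fun j hj => ?_) hi
  · have := hH (j + 1) (by omega) (by omega)
    simp only [Nat.add_sub_cancel] at this
    field_simp at this ⊢
    linarith
  · have := hpos (j + 1) (by omega) (by omega)
    simp only [dbh, Nat.add_sub_cancel] at this
    refine nonneg_of_mul_nonneg_right (a := (N : ℝ) ^ 4) (this.trans_eq ?_) (by positivity)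
    field_simp
    ring
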